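/- Let (H, μ, Δ, α_H, σ) be a coquasitriangular Hom-bialgebra such that σ = σ∘(α_H⊗α_H), and let (M, α_M) be a left H-comodule with coaction m ↦ m_{(-1)}⊗m_{(0)}. Define a linear action H⊗M→M by h·m := σ(m_{(-1)}⊗α_H(h)) m_{(0)}. Then (M, α_M) with the given coaction and this action is a Yetter-Drinfeld module over H; in particular the action makes (M, α_M) a left H-module and the Yetter-Drinfeld compatibility condition holds. -/

import Mathlib

open TensorProduct

noncomputable section

namespace HomYD

variable (k : Type*) [Field k]
variable {H M N : Type*}
variable [AddCommGroup H] [Module k H]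
variable [AddCommGroup M] [Module k M]
variable [AddCommGroup N] [Module k N]

/-- Rearrangement `(a ⊗ b) ⊗ c ↦ (a ⊗ c) ⊗ b`. -/
def rearr (A B C : Type*) [AddCommGroup A] [Module k A] [AddCommGroup B] [Module k B]
    [AddCommGroup C] [Module k C] :
    (A ⊗[k] B) ⊗[k] C →ₗ[k] (A ⊗[k] C) ⊗[k] B :=
  (TensorProduct.assoc k A C B).symm.toLinearMap ∘ₗ
    (TensorProduct.map LinearMap.id (TensorProduct.comm k B C).toLinearMap) ∘ₗ
      (TensorProduct.assoc k A B C).toLinearMap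

/-- Middle-four exchange `(a ⊗ b) ⊗ (c ⊗ d) ↦ (a ⊗ c) ⊗ (b ⊗ d)`. -/
def ttc (A B C D : Type*) [AddCommGroup A] [Module k A] [AddCommGroup B] [Module k B]
    [AddCommGroup C] [Module k C] [AddCommGroup D] [Module k D] :
    (A ⊗[k] B) ⊗[k] (C ⊗[k] D) →ₗ[k] (A ⊗[k] C) ⊗[k] (B ⊗[k] D) :=
  (TensorProduct.tensorTensorTensorComm k A B C D).toLinearMap

/-- Hom-bialgebra (no unit/counit): multiplicativity of `α`, Hom-associativity,
comultiplicativity of `α`, Hom-coassociativity, and `Δ` multiplicative. -/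
structure IsHomBialgebra (μ : H ⊗[k] H →ₗ[k] H) (Δ : H →ₗ[k] H ⊗[k] H)
    (α : H →ₗ[k] H) : Prop where
  mul_mult : ∀ a b : H, α (μ (a ⊗ₜ[k] b)) = μ (α a ⊗ₜ[k] α b)
  hom_assoc : ∀ a b c : H, μ (α a ⊗ₜ[k] μ (b ⊗ₜ[k] c)) = μ (μ (a ⊗ₜ[k] b) ⊗ₜ[k] α c)
  comul_compat : TensorProduct.map α α ∘ₗ Δ = Δ ∘ₗ α
  hom_coassoc : (TensorProduct.assoc k H H H).toLinearMap ∘ₗ TensorProduct.map Δ α ∘ₗ Δ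
      = TensorProduct.map α Δ ∘ₗ Δ
  comul_mul : Δ ∘ₗ μ
      = TensorProduct.map μ μ ∘ₗ ttc k H H H H ∘ₗ TensorProduct.map Δ Δ

/-- Left module over a Hom-(bi)algebra. -/
structure IsHomModule (μ : H ⊗[k] H →ₗ[k] H) (α : H →ₗ[k] H)
    (ρ : H ⊗[k] M →ₗ[k] M) (αM : M →ₗ[k] M) : Prop where
  str_compat : ∀ (h : H) (m : M), αM (ρ (h ⊗ₜ[k] m)) = ρ (α h ⊗ₜ[k] αM m)
  hom_smul : ∀ (h h' : H) (m : M),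
      ρ (α h ⊗ₜ[k] ρ (h' ⊗ₜ[k] m)) = ρ (μ (h ⊗ₜ[k] h') ⊗ₜ[k] αM m)

/-- Left comodule over a Hom-(bi)algebra. -/
structure IsHomComodule (Δ : H →ₗ[k] H ⊗[k] H) (α : H →ₗ[k] H)
    (lM : M →ₗ[k] H ⊗[k] M) (αM : M →ₗ[k] M) : Prop where
  str_compat : TensorProduct.map α αM ∘ₗ lM = lM ∘ₗ αM
  hom_coact : TensorProduct.map Δ αM ∘ₗ lM
      = (TensorProduct.assoc k H H M).symm.toLinearMap ∘ₗ TensorProduct.map α lM ∘ₗ lM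

/-- `h ⊗ m ↦ (h₁·m)₍₋₁₎ β(h₂) ⊗ (h₁·m)₍₀₎`. -/
def ydL (μ : H ⊗[k] H →ₗ[k] H) (Δ : H →ₗ[k] H ⊗[k] H) (β : H →ₗ[k] H)
    (ρ : H ⊗[k] M →ₗ[k] M) (lM : M →ₗ[k] H ⊗[k] M) : H ⊗[k] M →ₗ[k] H ⊗[k] M :=
  TensorProduct.map μ LinearMap.id ∘ₗ rearr k H M H ∘ₗ
    TensorProduct.map (lM ∘ₗ ρ) β ∘ₗ rearr k H H M ∘ₗ
      TensorProduct.map Δ LinearMap.id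

/-- `h ⊗ m ↦ β(h₁) γ(m₍₋₁₎) ⊗ γ(h₂)·m₍₀₎`. -/
def ydR (μ : H ⊗[k] H →ₗ[k] H) (Δ : H →ₗ[k] H ⊗[k] H) (β γ : H →ₗ[k] H)
    (ρ : H ⊗[k] M →ₗ[k] M) (lM : M →ₗ[k] H ⊗[k] M) : H ⊗[k] M →ₗ[k] H ⊗[k] M :=
  TensorProduct.map (μ ∘ₗ TensorProduct.map β γ) (ρ ∘ₗ TensorProduct.map γ LinearMap.id) ∘ₗ
    ttc k H H H M ∘ₗ TensorProduct.map Δ lM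

/-- Yetter-Drinfeld module over a Hom-bialgebra: Hom-module, Hom-comodule and the
compatibility `(h₁·m)₍₋₁₎ α²(h₂) ⊗ (h₁·m)₍₀₎ = α²(h₁) α(m₍₋₁₎) ⊗ α(h₂)·m₍₀₎`. -/
def IsYetterDrinfeld (μ : H ⊗[k] H →ₗ[k] H) (Δ : H →ₗ[k] H ⊗[k] H) (α : H →ₗ[k] H)
    (ρ : H ⊗[k] M →ₗ[k] M) (lM : M →ₗ[k] H ⊗[k] M) (αM : M →ₗ[k] M) : Prop :=
  IsHomModule k μ α ρ αM ∧ IsHomComodule k Δ α lM αM ∧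
    ydL k μ Δ (α ∘ₗ α) ρ lM = ydR k μ Δ (α ∘ₗ α) α ρ lM

/-- `m ⊗ n ↦ αHinv(m₍₋₁₎)·n ⊗ m₍₀₎`. -/
def Bmap (αHinv : H →ₗ[k] H) (lM : M →ₗ[k] H ⊗[k] M) (ρN : H ⊗[k] N →ₗ[k] N) :
    M ⊗[k] N →ₗ[k] N ⊗[k] M :=
  TensorProduct.map (ρN ∘ₗ TensorProduct.map αHinv LinearMap.id) LinearMap.id ∘ₗ
    rearr k H M N ∘ₗ TensorProduct.map lM LinearMap.id

/-- Quasi-braiding `m ⊗ n ↦ αN⁻¹(αH⁻¹(m₍₋₁₎)·n) ⊗ αM⁻¹(m₍₀₎)`. -/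
def braidYD (αH : H ≃ₗ[k] H) (αM : M ≃ₗ[k] M) (αN : N ≃ₗ[k] N)
    (lM : M →ₗ[k] H ⊗[k] M) (ρN : H ⊗[k] N →ₗ[k] N) : M ⊗[k] N →ₗ[k] N ⊗[k] M :=
  TensorProduct.map
      (αN.symm.toLinearMap ∘ₗ ρN ∘ₗ TensorProduct.map αH.symm.toLinearMap LinearMap.id)
      αM.symm.toLinearMap ∘ₗ rearr k H M N ∘ₗ TensorProduct.map lM LinearMap.id

/-- Action on `M ⊗ N`: `h ⊗ (m ⊗ n) ↦ h₁·m ⊗ h₂·n`. -/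
def hatAction (Δ : H →ₗ[k] H ⊗[k] H)
    (ρM : H ⊗[k] M →ₗ[k] M) (ρN : H ⊗[k] N →ₗ[k] N) :
    H ⊗[k] (M ⊗[k] N) →ₗ[k] M ⊗[k] N :=
  TensorProduct.map ρM ρN ∘ₗ ttc k H H M N ∘ₗ TensorProduct.map Δ LinearMap.id

/-- Coaction on `M ⊗ N`: `m ⊗ n ↦ αHinv²(m₍₋₁₎ n₍₋₁₎) ⊗ (m₍₀₎ ⊗ n₍₀₎)`. -/
def hatCoaction (μ : H ⊗[k] H →ₗ[k] H) (αHinv : H →ₗ[k] H)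
    (lM : M →ₗ[k] H ⊗[k] M) (lN : N →ₗ[k] H ⊗[k] N) :
    M ⊗[k] N →ₗ[k] H ⊗[k] (M ⊗[k] N) :=
  TensorProduct.map (αHinv ∘ₗ αHinv ∘ₗ μ) LinearMap.id ∘ₗ ttc k H M H N ∘ₗ
    TensorProduct.map lM lN

/-- Action on `M ⊗ N`: `h ⊗ (m ⊗ n) ↦ αHinv²(h₁)·m ⊗ αHinv²(h₂)·n`. -/
def tildeAction (Δ : H →ₗ[k] H ⊗[k] H) (αHinv : H →ₗ[k] H)
    (ρM : H ⊗[k] M →ₗ[k] M) (ρN : H ⊗[k] N →ₗ[k] N) :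
    H ⊗[k] (M ⊗[k] N) →ₗ[k] M ⊗[k] N :=
  TensorProduct.map ρM ρN ∘ₗ ttc k H H M N ∘ₗ
    TensorProduct.map
      (TensorProduct.map (αHinv ∘ₗ αHinv) (αHinv ∘ₗ αHinv) ∘ₗ Δ) LinearMap.id

/-- Coaction on `M ⊗ N`: `m ⊗ n ↦ m₍₋₁₎ n₍₋₁₎ ⊗ (m₍₀₎ ⊗ n₍₀₎)`. -/
def tildeCoaction (μ : H ⊗[k] H →ₗ[k] H)
    (lM : M →ₗ[k] H ⊗[k] M) (lN : N →ₗ[k] H ⊗[k] N) :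
    M ⊗[k] N →ₗ[k] H ⊗[k] (M ⊗[k] N) :=
  TensorProduct.map μ LinearMap.id ∘ₗ ttc k H M H N ∘ₗ TensorProduct.map lM lN

/-- Associator `(x ⊗ y) ⊗ z ↦ αX⁻¹(x) ⊗ (y ⊗ αZ(z))`. -/
def aYD {X Z : Type*} [AddCommGroup X] [Module k X] [AddCommGroup Z] [Module k Z]
    (αX : X ≃ₗ[k] X) (Y : Type*) [AddCommGroup Y] [Module k Y] (αZ : Z ≃ₗ[k] Z) :
    (X ⊗[k] Y) ⊗[k] Z →ₗ[k] X ⊗[k] (Y ⊗[k] Z) :=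
  (TensorProduct.assoc k X Y Z).toLinearMap ∘ₗ
    TensorProduct.map (TensorProduct.map αX.symm.toLinearMap LinearMap.id) αZ.toLinearMap

/-- Inverse associator `x ⊗ (y ⊗ z) ↦ (αX(x) ⊗ y) ⊗ αZ⁻¹(z)`. -/
def aYDinv {X Z : Type*} [AddCommGroup X] [Module k X] [AddCommGroup Z] [Module k Z]
    (αX : X ≃ₗ[k] X) (Y : Type*) [AddCommGroup Y] [Module k Y] (αZ : Z ≃ₗ[k] Z) :
    X ⊗[k] (Y ⊗[k] Z) →ₗ[k] (X ⊗[k] Y) ⊗[k] Z :=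
  TensorProduct.map (TensorProduct.map αX.toLinearMap LinearMap.id) αZ.symm.toLinearMap ∘ₗ
    (TensorProduct.assoc k X Y Z).symm.toLinearMap

/-- Associator `(x ⊗ y) ⊗ z ↦ αX(x) ⊗ (y ⊗ αZ⁻¹(z))`. -/
def aTilde {X Z : Type*} [AddCommGroup X] [Module k X] [AddCommGroup Z] [Module k Z]
    (αX : X ≃ₗ[k] X) (Y : Type*) [AddCommGroup Y] [Module k Y] (αZ : Z ≃ₗ[k] Z) :
    (X ⊗[k] Y) ⊗[k] Z →ₗ[k] X ⊗[k] (Y ⊗[k] Z) :=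
  (TensorProduct.assoc k X Y Z).toLinearMap ∘ₗ
    TensorProduct.map (TensorProduct.map αX.toLinearMap LinearMap.id) αZ.symm.toLinearMap

/-- Inverse associator `x ⊗ (y ⊗ z) ↦ (αX⁻¹(x) ⊗ y) ⊗ αZ(z)`. -/
def aTildeInv {X Z : Type*} [AddCommGroup X] [Module k X] [AddCommGroup Z] [Module k Z]
    (αX : X ≃ₗ[k] X) (Y : Type*) [AddCommGroup Y] [Module k Y] (αZ : Z ≃ₗ[k] Z) :
    X ⊗[k] (Y ⊗[k] Z) →ₗ[k] (X ⊗[k] Y) ⊗[k] Z :=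
  TensorProduct.map (TensorProduct.map αX.symm.toLinearMap LinearMap.id) αZ.toLinearMap ∘ₗ
    (TensorProduct.assoc k X Y Z).symm.toLinearMap

/-- Quasitriangular Hom-bialgebra. -/
def IsQuasitriangular (μ : H ⊗[k] H →ₗ[k] H) (Δ : H →ₗ[k] H ⊗[k] H) (α : H →ₗ[k] H)
    (R : H ⊗[k] H) : Prop :=
  IsHomBialgebra k μ Δ α ∧
  TensorProduct.map Δ α R
    = TensorProduct.map (TensorProduct.map α α) μ (ttc k H H H H (R ⊗ₜ[k] R)) ∧
  TensorProduct.map α Δ R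
    = TensorProduct.map μ (TensorProduct.map α α ∘ₗ (TensorProduct.comm k H H).toLinearMap)
        (ttc k H H H H (R ⊗ₜ[k] R)) ∧
  ∀ h : H, TensorProduct.map μ μ (ttc k H H H H ((TensorProduct.comm k H H (Δ h)) ⊗ₜ[k] R))
      = TensorProduct.map μ μ (ttc k H H H H (R ⊗ₜ[k] Δ h))

/-- Coaction induced by an R-matrix: `m ↦ α(R²) ⊗ R¹·m`. -/
def coactionFromR (R : H ⊗[k] H) (α : H →ₗ[k] H) (ρM : H ⊗[k] M →ₗ[k] M) :
    M →ₗ[k] H ⊗[k] M :=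
  (TensorProduct.comm k M H).toLinearMap ∘ₗ TensorProduct.map ρM α ∘ₗ rearr k H H M ∘ₗ
    TensorProduct.mk k (H ⊗[k] H) M R

/-- Quasi-braiding from an R-matrix: `m ⊗ n ↦ αN⁻¹(R²·n) ⊗ αM⁻¹(R¹·m)`. -/
def braidR (R : H ⊗[k] H) (ρM : H ⊗[k] M →ₗ[k] M) (ρN : H ⊗[k] N →ₗ[k] N)
    (αM : M ≃ₗ[k] M) (αN : N ≃ₗ[k] N) : M ⊗[k] N →ₗ[k] N ⊗[k] M :=
  TensorProduct.map αN.symm.toLinearMap αM.symm.toLinearMap ∘ₗ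
    (TensorProduct.comm k M N).toLinearMap ∘ₗ TensorProduct.map ρM ρN ∘ₗ
      ttc k H H M N ∘ₗ TensorProduct.mk k (H ⊗[k] H) (M ⊗[k] N) R

/-- Coquasitriangular Hom-bialgebra. -/
def IsCoquasitriangular (μ : H ⊗[k] H →ₗ[k] H) (Δ : H →ₗ[k] H ⊗[k] H) (α : H →ₗ[k] H)
    (σ : H ⊗[k] H →ₗ[k] k) : Prop :=
  IsHomBialgebra k μ Δ α ∧
  (∀ x y z : H, σ (μ (x ⊗ₜ[k] y) ⊗ₜ[k] α z)
      = LinearMap.mul' k k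
          (TensorProduct.map σ σ (ttc k H H H H ((α x ⊗ₜ[k] α y) ⊗ₜ[k] Δ z)))) ∧
  (∀ x y z : H, σ (α x ⊗ₜ[k] μ (y ⊗ₜ[k] z))
      = LinearMap.mul' k k
          (TensorProduct.map σ σ (ttc k H H H H (Δ x ⊗ₜ[k] (α z ⊗ₜ[k] α y))))) ∧
  (∀ x y : H,
      (TensorProduct.rid k H)
        (TensorProduct.map (μ ∘ₗ (TensorProduct.comm k H H).toLinearMap) σ
          (ttc k H H H H (Δ x ⊗ₜ[k] Δ y)))
      = (TensorProduct.lid k H)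
          (TensorProduct.map σ μ (ttc k H H H H (Δ x ⊗ₜ[k] Δ y))))

/-- Action induced by a coquasitriangular form: `h ⊗ m ↦ σ(m₍₋₁₎ ⊗ α(h)) • m₍₀₎`. -/
def actionFromSigma (σ : H ⊗[k] H →ₗ[k] k) (α : H →ₗ[k] H)
    (lM : M →ₗ[k] H ⊗[k] M) : H ⊗[k] M →ₗ[k] M :=
  (TensorProduct.lid k M).toLinearMap ∘ₗ
    TensorProduct.map (σ ∘ₗ TensorProduct.map LinearMap.id α ∘ₗ
        (TensorProduct.comm k H H).toLinearMap) LinearMap.id ∘ₗ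
      (TensorProduct.assoc k H H M).symm.toLinearMap ∘ₗ
        TensorProduct.map LinearMap.id lM

/-- Quasi-braiding from a coquasitriangular form:
`m ⊗ n ↦ σ(n₍₋₁₎ ⊗ m₍₋₁₎) • (αN⁻¹(n₍₀₎) ⊗ αM⁻¹(m₍₀₎))`. -/
def braidSigma (σ : H ⊗[k] H →ₗ[k] k)
    (lM : M →ₗ[k] H ⊗[k] M) (lN : N →ₗ[k] H ⊗[k] N)
    (αM : M ≃ₗ[k] M) (αN : N ≃ₗ[k] N) : M ⊗[k] N →ₗ[k] N ⊗[k] M :=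
  (TensorProduct.lid k (N ⊗[k] M)).toLinearMap ∘ₗ
    TensorProduct.map (σ ∘ₗ (TensorProduct.comm k H H).toLinearMap)
      (TensorProduct.map αN.symm.toLinearMap αM.symm.toLinearMap ∘ₗ
        (TensorProduct.comm k M N).toLinearMap) ∘ₗ
      ttc k H M H N ∘ₗ TensorProduct.map lM lN


@[simp]
lemma rearr_tmul {A B C : Type*} [AddCommGroup A] [Module k A] [AddCommGroup B] [Module k B]
    [AddCommGroup C] [Module k C] (a : A) (b : B) (c : C) :
    rearr k A B C ((a ⊗ₜ[k] b) ⊗ₜ[k] c) = (a ⊗ₜ[k] c) ⊗ₜ[k] b := rfl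

@[simp]
lemma ttc_tmul {A B C D : Type*} [AddCommGroup A] [Module k A] [AddCommGroup B] [Module k B]
    [AddCommGroup C] [Module k C] [AddCommGroup D] [Module k D] (a : A) (b : B) (c : C) (d : D) :
    ttc k A B C D ((a ⊗ₜ[k] b) ⊗ₜ[k] (c ⊗ₜ[k] d)) = (a ⊗ₜ[k] c) ⊗ₜ[k] (b ⊗ₜ[k] d) := rfl

/-- `a ⊗ m ↦ σ(a ⊗ y) • m`. -/
def evalRight (σ : H ⊗[k] H →ₗ[k] k) (y : H) : H ⊗[k] M →ₗ[k] M :=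
  (TensorProduct.lid k M).toLinearMap ∘ₗ
    TensorProduct.map (σ ∘ₗ (TensorProduct.mk k H H).flip y) LinearMap.id

@[simp]
lemma evalRight_tmul (σ : H ⊗[k] H →ₗ[k] k) (y a : H) (m : M) :
    evalRight k σ y (a ⊗ₜ[k] m) = σ (a ⊗ₜ[k] y) • m := rfl

lemma actionFromSigma_tmul (σ : H ⊗[k] H →ₗ[k] k) (α : H →ₗ[k] H) (lM : M →ₗ[k] H ⊗[k] M)
    (h : H) (m : M) :
    actionFromSigma k σ α lM (h ⊗ₜ[k] m) = evalRight k σ (α h) (lM m) := by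
  simp only [actionFromSigma, LinearMap.comp_apply, TensorProduct.map_tmul, LinearMap.id_apply]
  induction lM m with
  | zero => simp
  | add x y hx hy => simp only [TensorProduct.tmul_add, map_add, hx, hy]
  | tmul a n => simp

/-- `(a ⊗ b) ⊗ m ↦ σ(a ⊗ y) σ(b ⊗ z) • m`. -/
def evalRightTwo (σ : H ⊗[k] H →ₗ[k] k) (y z : H) : (H ⊗[k] H) ⊗[k] M →ₗ[k] M :=
  (TensorProduct.lid k M).toLinearMap ∘ₗ
    TensorProduct.map (LinearMap.mul' k k ∘ₗ TensorProduct.map σ σ ∘ₗ ttc k H H H H ∘ₗ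
      (TensorProduct.mk k (H ⊗[k] H) (H ⊗[k] H)).flip (y ⊗ₜ[k] z)) LinearMap.id

@[simp]
lemma evalRightTwo_tmul (σ : H ⊗[k] H →ₗ[k] k) (y z : H) (d : H ⊗[k] H) (m : M) :
    evalRightTwo k σ y z (d ⊗ₜ[k] m) = LinearMap.mul' k k
      (TensorProduct.map σ σ (ttc k H H H H (d ⊗ₜ[k] (y ⊗ₜ[k] z)))) • m := rfl

lemma evalRight_coact_evalRight (σ : H ⊗[k] H →ₗ[k] k) (α : H →ₗ[k] H)
    (hσ : ∀ a b, σ (α a ⊗ₜ[k] α b) = σ (a ⊗ₜ[k] b)) (lM : M →ₗ[k] H ⊗[k] M) (y z : H)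
    (t : H ⊗[k] M) :
    evalRight k σ z (lM (evalRight k σ y t)) = evalRightTwo k σ (α y) z
      ((TensorProduct.assoc k H H M).symm (TensorProduct.map α lM t)) := by
  induction t with
  | zero => simp
  | add x y hx hy => simp only [map_add, hx, hy]
  | tmul a n =>
    simp only [evalRight_tmul, map_smul, TensorProduct.map_tmul]
    induction lM n with
    | zero => simp
    | add x y hx hy => simp only [TensorProduct.tmul_add, map_add, smul_add, hx, hy]
    | tmul b p => simp [hσ, mul_smul]

/-- `(a ⊗ b) ⊗ m ↦ σ(a ⊗ d₁) b d₂ ⊗ m`. -/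
def pairThenMul (μ : H ⊗[k] H →ₗ[k] H) (σ : H ⊗[k] H →ₗ[k] k) (d : H ⊗[k] H) :
    (H ⊗[k] H) ⊗[k] M →ₗ[k] H ⊗[k] M :=
  TensorProduct.map ((TensorProduct.lid k H).toLinearMap ∘ₗ TensorProduct.map σ μ ∘ₗ
    ttc k H H H H ∘ₗ (TensorProduct.mk k (H ⊗[k] H) (H ⊗[k] H)).flip d) LinearMap.id

/-- `(a ⊗ b) ⊗ m ↦ d₁ a σ(b ⊗ d₂) ⊗ m`. -/
def mulThenPair (μ : H ⊗[k] H →ₗ[k] H) (σ : H ⊗[k] H →ₗ[k] k) (d : H ⊗[k] H) :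
    (H ⊗[k] H) ⊗[k] M →ₗ[k] H ⊗[k] M :=
  TensorProduct.map ((TensorProduct.rid k H).toLinearMap ∘ₗ
    TensorProduct.map (μ ∘ₗ (TensorProduct.comm k H H).toLinearMap) σ ∘ₗ
    ttc k H H H H ∘ₗ (TensorProduct.mk k (H ⊗[k] H) (H ⊗[k] H)).flip d) LinearMap.id

@[simp]
lemma pairThenMul_tmul (μ : H ⊗[k] H →ₗ[k] H) (σ : H ⊗[k] H →ₗ[k] k) (d e : H ⊗[k] H) (m : M) :
    pairThenMul k μ σ d (e ⊗ₜ[k] m) = (TensorProduct.lid k H)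
      (TensorProduct.map σ μ (ttc k H H H H (e ⊗ₜ[k] d))) ⊗ₜ[k] m := rfl

@[simp]
lemma mulThenPair_tmul (μ : H ⊗[k] H →ₗ[k] H) (σ : H ⊗[k] H →ₗ[k] k) (d e : H ⊗[k] H) (m : M) :
    mulThenPair k μ σ d (e ⊗ₜ[k] m) = (TensorProduct.rid k H)
      (TensorProduct.map (μ ∘ₗ (TensorProduct.comm k H H).toLinearMap) σ
        (ttc k H H H H (e ⊗ₜ[k] d))) ⊗ₜ[k] m := rfl

lemma pairThenMul_add (μ : H ⊗[k] H →ₗ[k] H) (σ : H ⊗[k] H →ₗ[k] k) (d e : H ⊗[k] H) :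
    pairThenMul k μ σ (d + e) = (pairThenMul k μ σ d + pairThenMul k μ σ e :
      (H ⊗[k] H) ⊗[k] M →ₗ[k] H ⊗[k] M) := by
  simp only [pairThenMul, map_add, LinearMap.comp_add, TensorProduct.map_add_left]

lemma mulThenPair_add (μ : H ⊗[k] H →ₗ[k] H) (σ : H ⊗[k] H →ₗ[k] k) (d e : H ⊗[k] H) :
    mulThenPair k μ σ (d + e) = (mulThenPair k μ σ d + mulThenPair k μ σ e :
      (H ⊗[k] H) ⊗[k] M →ₗ[k] H ⊗[k] M) := by
  simp only [mulThenPair, map_add, LinearMap.comp_add, TensorProduct.map_add_left]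

@[simp]
lemma pairThenMul_zero (μ : H ⊗[k] H →ₗ[k] H) (σ : H ⊗[k] H →ₗ[k] k) :
    pairThenMul k μ σ 0 = (0 : (H ⊗[k] H) ⊗[k] M →ₗ[k] H ⊗[k] M) := by
  simp [pairThenMul]

@[simp]
lemma mulThenPair_zero (μ : H ⊗[k] H →ₗ[k] H) (σ : H ⊗[k] H →ₗ[k] k) :
    mulThenPair k μ σ 0 = (0 : (H ⊗[k] H) ⊗[k] M →ₗ[k] H ⊗[k] M) := by
  simp [mulThenPair]

lemma ydL_actionFromSigma (μ : H ⊗[k] H →ₗ[k] H) (Δ : H →ₗ[k] H ⊗[k] H) (α : H →ₗ[k] H)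
    (σ : H ⊗[k] H →ₗ[k] k) (hσ : ∀ a b, σ (α a ⊗ₜ[k] α b) = σ (a ⊗ₜ[k] b))
    (lM : M →ₗ[k] H ⊗[k] M) (h : H) (m : M) :
    ydL k μ Δ (α ∘ₗ α) (actionFromSigma k σ α lM) lM (h ⊗ₜ[k] m) =
      pairThenMul k μ σ (TensorProduct.map (α ∘ₗ α) (α ∘ₗ α) (Δ h))
        ((TensorProduct.assoc k H H M).symm (TensorProduct.map α lM (lM m))) := by
  simp only [ydL, LinearMap.comp_apply, TensorProduct.map_tmul, LinearMap.id_apply]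
  induction Δ h with
  | zero => simp
  | add x y hx hy =>
    simp only [TensorProduct.add_tmul, map_add, pairThenMul_add, LinearMap.add_apply, hx, hy]
  | tmul p q =>
    simp only [rearr_tmul, TensorProduct.map_tmul, LinearMap.comp_apply, actionFromSigma_tmul]
    induction lM m with
    | zero => simp
    | add x y hx hy => simp only [TensorProduct.add_tmul, map_add, hx, hy]
    | tmul a n =>
      simp only [evalRight_tmul, map_smul, TensorProduct.map_tmul]
      induction lM n with
      | zero => simp
      | add x y hx hy =>
        simp only [smul_add, TensorProduct.add_tmul, TensorProduct.tmul_add, map_add, hx, hy]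
      | tmul b r => simp [hσ, ← TensorProduct.smul_tmul']

lemma ydR_actionFromSigma (μ : H ⊗[k] H →ₗ[k] H) (Δ : H →ₗ[k] H ⊗[k] H) (α : H →ₗ[k] H)
    (σ : H ⊗[k] H →ₗ[k] k) (lM : M →ₗ[k] H ⊗[k] M) (h : H) (m : M) :
    ydR k μ Δ (α ∘ₗ α) α (actionFromSigma k σ α lM) lM (h ⊗ₜ[k] m) =
      mulThenPair k μ σ (TensorProduct.map (α ∘ₗ α) (α ∘ₗ α) (Δ h))
        ((TensorProduct.assoc k H H M).symm (TensorProduct.map α lM (lM m))) := by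
  simp only [ydR, LinearMap.comp_apply, TensorProduct.map_tmul]
  induction Δ h with
  | zero => simp
  | add x y hx hy =>
    simp only [TensorProduct.add_tmul, map_add, mulThenPair_add, LinearMap.add_apply, hx, hy]
  | tmul p q =>
    induction lM m with
    | zero => simp
    | add x y hx hy => simp only [TensorProduct.tmul_add, map_add, hx, hy]
    | tmul a n =>
      simp only [ttc_tmul, TensorProduct.map_tmul, LinearMap.comp_apply, LinearMap.id_apply,
        actionFromSigma_tmul]
      induction lM n with
      | zero => simp
      | add x y hx hy => simp only [TensorProduct.tmul_add, map_add, hx, hy]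
      | tmul b r => simp [TensorProduct.smul_tmul]

/-- a left comodule over a coquasitriangular Hom-bialgebra with
`σ = σ ∘ (α ⊗ α)` becomes a Yetter-Drinfeld module with action
`h·m := σ(m₍₋₁₎ ⊗ α(h)) m₍₀₎`. -/
theorem stmt17 {k H M : Type*} [Field k]
    [AddCommGroup H] [Module k H] [AddCommGroup M] [Module k M]
    (μ : H ⊗[k] H →ₗ[k] H) (Δ : H →ₗ[k] H ⊗[k] H) (αH : H →ₗ[k] H)
    (σ : H ⊗[k] H →ₗ[k] k)
    (hCQT : IsCoquasitriangular k μ Δ αH σ)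
    (hσ : σ ∘ₗ TensorProduct.map αH αH = σ)
    (lM : M →ₗ[k] H ⊗[k] M) (αM : M →ₗ[k] M)
    (hM : IsHomComodule k Δ αH lM αM) :
    IsYetterDrinfeld k μ Δ αH (actionFromSigma k σ αH lM) lM αM := by
  obtain ⟨hB, -, hσmul, hcomm⟩ := hCQT
  have hσ' : ∀ a b, σ (αH a ⊗ₜ[k] αH b) = σ (a ⊗ₜ[k] b) := fun a b =>
    LinearMap.congr_fun hσ (a ⊗ₜ[k] b)
  have hlM : ∀ m, lM (αM m) = TensorProduct.map αH αM (lM m) := fun m =>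
    (LinearMap.congr_fun hM.str_compat m).symm
  have hco : ∀ m, (TensorProduct.assoc k H H M).symm (TensorProduct.map αH lM (lM m)) =
      TensorProduct.map Δ αM (lM m) := fun m => (LinearMap.congr_fun hM.hom_coact m).symm
  have hΔ : ∀ h, Δ (αH h) = TensorProduct.map αH αH (Δ h) := fun h =>
    (LinearMap.congr_fun hB.comul_compat h).symm
  refine ⟨⟨fun h m => ?_, fun h h' m => ?_⟩, hM, TensorProduct.ext' fun h m => ?_⟩
  · rw [actionFromSigma_tmul, actionFromSigma_tmul, hlM]
    induction lM m with
    | zero => simp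
    | add x y hx hy => simp only [map_add, hx, hy]
    | tmul a n => simp [hσ']
  · rw [actionFromSigma_tmul, actionFromSigma_tmul, actionFromSigma_tmul,
      evalRight_coact_evalRight k σ αH hσ', hco, hlM]
    induction lM m with
    | zero => simp
    | add x y hx hy => simp only [map_add, hx, hy]
    | tmul a n => simp [hB.mul_mult, hσmul]
  · rw [ydL_actionFromSigma k μ Δ αH σ hσ', ydR_actionFromSigma, hco, TensorProduct.map_comp,
      LinearMap.comp_apply, ← hΔ, ← hΔ]
    induction lM m with
    | zero => simp
    | add x y hx hy => simp only [map_add, hx, hy]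
    | tmul a n =>
      rw [TensorProduct.map_tmul, pairThenMul_tmul, mulThenPair_tmul, hcomm]


end HomYD
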